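/- Let k ≥ 1. The Markov kernel Q is ergodic on [2,2k²]^k: there exists a probability measure ν_k on (0,∞)^k such that for every probability measure ν^{(0)} on (0,∞)^k with ν^{(0)}([2,2k²]^k) = 1, the sequence of measures ν^{(0)}Q^n (the law after n steps of the Markov chain with kernel Q started from ν^{(0)}) converges weakly, as n → ∞, to ν_k; in particular the limit does not depend on ν^{(0)}. -/

import Mathlib

open MeasureTheory ProbabilityTheory Real Finset

noncomputable section

/-- Density of the centred Gaussian law with variance `g`. -/
def Phi (g y : ℝ) : ℝ := (Real.sqrt (2 * Real.pi * g))⁻¹ * Real.exp (-(y ^ 2) / (2 * g))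

/-- Partial sums: `xbar x j = x 0 + ⋯ + x (j-1)` (i.e. `x̄_j`), with `x̄_0 = 0`. -/
def xbar {k : ℕ} (x : Fin k → ℝ) (j : Fin (k + 1)) : ℝ :=
  ∑ i : Fin k, if (i : ℕ) < (j : ℕ) then x i else 0

/-- The density `Ψ_g` of the gaps sequence of iterated Brownian motion. -/
def Psi {k : ℕ} (g x : Fin k → ℝ) : ℝ :=
  ∑ τ : Equiv.Perm (Fin (k + 1)), ∏ i : Fin k,
    Phi (g i) (xbar x (τ i.succ) - xbar x (τ i.castSucc))

/-- The gaps sequence of a `(k+1)`-tuple of reals. -/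
def gaps {k : ℕ} (ℓ : Fin (k + 1) → ℝ) : Fin k → ℝ :=
  fun i => ℓ (Tuple.sort ℓ i.succ) - ℓ (Tuple.sort ℓ i.castSucc)

/-- `E_{τ,i}`: the set of `j ∈ {1,…,k}` with `min(τ(j-1),τ(j)) < i ≤ max(τ(j-1),τ(j))`
(index `j : Fin k` represents `j+1`, `i : Fin k` represents `i+1`). -/
def Eset {k : ℕ} (τ : Equiv.Perm (Fin (k + 1))) (i : Fin k) : Finset (Fin k) :=
  Finset.univ.filter (fun j : Fin k =>
    min ((τ j.castSucc : Fin (k + 1)) : ℕ) ((τ j.succ : Fin (k + 1)) : ℕ) < (i : ℕ) + 1 ∧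
      (i : ℕ) + 1 ≤ max ((τ j.castSucc : Fin (k + 1)) : ℕ) ((τ j.succ : Fin (k + 1)) : ℕ))

/-- `F_{τ,i}(λ) = Σ_{j ∈ E_{τ,i}} √(2 λ_j)`. -/
def F {k : ℕ} (τ : Equiv.Perm (Fin (k + 1))) (i : Fin k) (l : Fin k → ℝ) : ℝ :=
  ∑ j ∈ Eset τ i, Real.sqrt (2 * l j)

/-- `w_τ(λ) = 2^{-k} Π_i √(2 λ_i) / F_{τ,i}(λ)`. -/
def w {k : ℕ} (τ : Equiv.Perm (Fin (k + 1))) (l : Fin k → ℝ) : ℝ :=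
  (2 : ℝ)⁻¹ ^ k * ∏ i : Fin k, Real.sqrt (2 * l i) / F τ i l

/-- The mixture of products of exponential densities with parameter law `ν`:
`f_ν(x) = ∫ Π_i λ_i e^{−λ_i x_i} dν(λ)`. -/
def fmix {k : ℕ} (ν : Measure (Fin k → ℝ)) (x : Fin k → ℝ) : ℝ :=
  ∫ l, ∏ i : Fin k, l i * Real.exp (-(l i * x i)) ∂ν

/-- The Markov kernel `Q(λ, ·) = Σ_{τ ∈ S(0..k)} w_τ(λ) δ_{F_τ(λ)}` at the parameter
level; `ν.bind Qker` is the measure `νQ : A ↦ ∫ Σ_τ w_τ(λ) 1_{F_τ(λ) ∈ A} dν(λ)`. -/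
def Qker {k : ℕ} (l : Fin k → ℝ) : Measure (Fin k → ℝ) :=
  ∑ τ : Equiv.Perm (Fin (k + 1)),
    ENNReal.ofReal (w τ l) • Measure.dirac (fun i => F τ i l)

/-- The total weight of the path edges crossing the level `i` when vertex `v` has rank `σ v`. -/
def levelSum {k : ℕ} (σ : Equiv.Perm (Fin (k + 1))) (c : Fin k → ℝ) (i : ℕ) : ℝ :=
  ∑ j : Fin k, if min (σ j.castSucc : ℕ) (σ j.succ) < i ∧ i ≤ max (σ j.castSucc : ℕ) (σ j.succ)
    then c j else 0

lemma levelSum_zero {k : ℕ} (σ : Equiv.Perm (Fin (k + 1))) (c : Fin k → ℝ) :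
    levelSum σ c 0 = 0 := by
  simp [levelSum]

lemma levelSum_eq_zero_of_lt {k : ℕ} (σ : Equiv.Perm (Fin (k + 1))) (c : Fin k → ℝ) {i : ℕ}
    (hi : k < i) : levelSum σ c i = 0 := by
  refine Finset.sum_eq_zero fun j _ => if_neg ?_
  have h1 := (σ j.castSucc).isLt
  have h2 := (σ j.succ).isLt
  omega

lemma Eset_nonempty {k : ℕ} (σ : Equiv.Perm (Fin (k + 1))) (i : Fin k) : (Eset σ i).Nonempty := by
  by_contra hne
  have hE : ∀ j : Fin k, ((σ j.castSucc : ℕ) ≤ i ↔ (σ j.succ : ℕ) ≤ i) := by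
    intro j
    by_contra hj
    refine hne ⟨j, ?_⟩
    simp only [Eset, Finset.mem_filter, Finset.mem_univ, true_and]
    omega
  have hall : ∀ v : Fin (k + 1), ((σ v : ℕ) ≤ i ↔ (σ 0 : ℕ) ≤ i) := by
    intro v
    induction v using Fin.induction with
    | zero => rfl
    | succ j ih => rw [← hE j, ih]
  have h0 := hall (σ.symm 0)
  have h1 := hall (σ.symm (Fin.last k))
  have := i.isLt
  simp only [Equiv.apply_symm_apply, Fin.val_last, Fin.val_zero] at h0 h1
  omega

lemma sum_Eset {k : ℕ} (σ : Equiv.Perm (Fin (k + 1))) (c : Fin k → ℝ) (i : Fin k) :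
    ∑ j ∈ Eset σ i, c j = levelSum σ c (i + 1) := by
  rw [Eset, Finset.sum_filter, levelSum]

lemma levelSum_pos {k : ℕ} (σ : Equiv.Perm (Fin (k + 1))) {c : Fin k → ℝ} (hc : ∀ j, 0 < c j)
    {i : ℕ} (h1 : 1 ≤ i) (hi : i ≤ k) : 0 < levelSum σ c i := by
  obtain ⟨i, rfl⟩ := Nat.exists_eq_add_of_le' h1
  rw [← sum_Eset σ c ⟨i, hi⟩]
  exact Finset.sum_pos (fun j _ => hc j) (Eset_nonempty σ _)

/-- Insert a last vertex of rank `q` into a ranking of the vertices of a path. -/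
def insertLast {n : ℕ} (q : Fin (n + 1)) (σ : Equiv.Perm (Fin n)) : Equiv.Perm (Fin (n + 1)) :=
  ((finSuccEquiv' (Fin.last n)).trans σ.optionCongr).trans (finSuccEquiv' q).symm

@[simp] lemma insertLast_last {n : ℕ} (q : Fin (n + 1)) (σ : Equiv.Perm (Fin n)) :
    insertLast q σ (Fin.last n) = q := by
  simp [insertLast]

@[simp] lemma insertLast_castSucc {n : ℕ} (q : Fin (n + 1)) (σ : Equiv.Perm (Fin n)) (v : Fin n) :
    insertLast q σ v.castSucc = q.succAbove (σ v) := by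
  have h := finSuccEquiv'_succAbove (Fin.last n) v
  rw [Fin.succAbove_last] at h
  simp [insertLast, h]

lemma insertLast_bijective (n : ℕ) : Function.Bijective
    fun p : Fin (n + 1) × Equiv.Perm (Fin n) => insertLast p.1 p.2 := by
  rw [Fintype.bijective_iff_injective_and_card]
  constructor
  · rintro ⟨q, σ⟩ ⟨q', σ'⟩ h
    have hq : q = q' := by
      have := DFunLike.congr_fun h (Fin.last n)
      simpa using this
    subst hq
    refine Prod.ext rfl (Equiv.ext fun v => ?_)
    have := DFunLike.congr_fun h v.castSucc
    simpa using this
  · simp [Fintype.card_perm, Nat.factorial_succ]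

lemma succAbove_lt_iff_of_le {n : ℕ} (q : Fin (n + 1)) (v : Fin n) {i : ℕ} (hi : i ≤ q) :
    (q.succAbove v : ℕ) < i ↔ (v : ℕ) < i := by
  rcases lt_or_ge v.castSucc q with h | h
  · rw [Fin.succAbove_of_castSucc_lt _ _ h]; simp
  · rw [Fin.succAbove_of_le_castSucc _ _ h]
    have : (q : ℕ) ≤ v := h
    simp only [Fin.val_succ]; omega

lemma succAbove_lt_succ_iff_of_le {n : ℕ} (q : Fin (n + 1)) (v : Fin n) {i : ℕ} (hi : (q : ℕ) ≤ i) :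
    (q.succAbove v : ℕ) < i + 1 ↔ (v : ℕ) < i := by
  rcases lt_or_ge v.castSucc q with h | h
  · rw [Fin.succAbove_of_castSucc_lt _ _ h]
    have : (v : ℕ) < q := h
    simp only [Fin.val_castSucc]; omega
  · rw [Fin.succAbove_of_le_castSucc _ _ h]
    simp only [Fin.val_succ]; omega

lemma levelSum_insertLast {k : ℕ} (q : Fin (k + 2)) (σ : Equiv.Perm (Fin (k + 1)))
    (c : Fin (k + 1) → ℝ) (i : ℕ) :
    levelSum (insertLast q σ) c i =
      (∑ j : Fin k, if min (q.succAbove (σ j.castSucc) : ℕ) (q.succAbove (σ j.succ)) < i ∧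
        i ≤ max (q.succAbove (σ j.castSucc) : ℕ) (q.succAbove (σ j.succ))
        then c j.castSucc else 0) +
      if min (q.succAbove (σ (Fin.last k)) : ℕ) q < i ∧
        i ≤ max (q.succAbove (σ (Fin.last k)) : ℕ) q then c (Fin.last k) else 0 := by
  rw [levelSum, Fin.sum_univ_castSucc]
  simp only [← Fin.castSucc_succ, insertLast_castSucc, Fin.succ_last, insertLast_last]

lemma levelSum_insertLast_of_le {k : ℕ} (q : Fin (k + 2)) (σ : Equiv.Perm (Fin (k + 1)))
    (c : Fin (k + 1) → ℝ) {i : ℕ} (hi : i ≤ q) :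
    levelSum (insertLast q σ) c i = levelSum σ (fun j => c j.castSucc) i +
      if (σ (Fin.last k) : ℕ) < i then c (Fin.last k) else 0 := by
  rw [levelSum_insertLast, levelSum]
  congr 1
  · refine Finset.sum_congr rfl fun j _ => if_congr ?_ rfl rfl
    have h1 := succAbove_lt_iff_of_le q (σ j.castSucc) hi
    have h2 := succAbove_lt_iff_of_le q (σ j.succ) hi
    omega
  · refine if_congr ?_ rfl rfl
    have h1 := succAbove_lt_iff_of_le q (σ (Fin.last k)) hi
    omega

lemma levelSum_insertLast_succ_of_le {k : ℕ} (q : Fin (k + 2)) (σ : Equiv.Perm (Fin (k + 1)))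
    (c : Fin (k + 1) → ℝ) {i : ℕ} (hi : (q : ℕ) ≤ i) :
    levelSum (insertLast q σ) c (i + 1) = levelSum σ (fun j => c j.castSucc) i +
      if i ≤ (σ (Fin.last k) : ℕ) then c (Fin.last k) else 0 := by
  rw [levelSum_insertLast, levelSum]
  congr 1
  · refine Finset.sum_congr rfl fun j _ => if_congr ?_ rfl rfl
    have h1 := succAbove_lt_succ_iff_of_le q (σ j.castSucc) hi
    have h2 := succAbove_lt_succ_iff_of_le q (σ j.succ) hi
    omega
  · refine if_congr ?_ rfl rfl
    have h1 := succAbove_lt_succ_iff_of_le q (σ (Fin.last k)) hi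
    omega

lemma prod_levelSum_insertLast {k : ℕ} (q : Fin (k + 2)) (σ : Equiv.Perm (Fin (k + 1)))
    (c : Fin (k + 1) → ℝ) :
    ∏ i ∈ Finset.Ico 1 (k + 2), (levelSum (insertLast q σ) c i)⁻¹ =
      (∏ i ∈ Finset.Ico 1 ((q : ℕ) + 1), (levelSum σ (fun j => c j.castSucc) i +
        if (σ (Fin.last k) : ℕ) < i then c (Fin.last k) else 0)⁻¹) *
      ∏ i ∈ Finset.Ico (q : ℕ) (k + 1), (levelSum σ (fun j => c j.castSucc) i +
        if i ≤ (σ (Fin.last k) : ℕ) then c (Fin.last k) else 0)⁻¹ := by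
  have hq := q.isLt
  rw [← Finset.prod_Ico_consecutive _ (show 1 ≤ (q : ℕ) + 1 by omega)
    (show (q : ℕ) + 1 ≤ k + 2 by omega)]
  congr 1
  · refine Finset.prod_congr rfl fun i hi => ?_
    rw [levelSum_insertLast_of_le]
    have := Finset.mem_Ico.1 hi
    omega
  · rw [← Finset.prod_Ico_add' _ (q : ℕ) (k + 1) 1]
    refine Finset.prod_congr rfl fun i hi => ?_
    rw [levelSum_insertLast_succ_of_le]
    exact (Finset.mem_Ico.1 hi).1

/-- Summing over all the insertion levels of a new edge of weight `c` at a vertex of rank `p`. -/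
lemma sum_insertion_levels {D : ℕ → ℝ} {c : ℝ} {p k : ℕ} (hc : 0 < c) (hp : p ≤ k)
    (h0 : D 0 = 0) (hk : D (k + 1) = 0) (hD : ∀ i, 1 ≤ i → i ≤ k → 0 < D i) :
    ∑ q ∈ Finset.range (k + 2),
      (∏ i ∈ Finset.Ico 1 (q + 1), (D i + if p < i then c else 0)⁻¹) *
        ∏ i ∈ Finset.Ico q (k + 1), (D i + if i ≤ p then c else 0)⁻¹ =
      2 / c * ∏ i ∈ Finset.Ico 1 (k + 1), (D i)⁻¹ := by
  set up : ℕ → ℝ := fun i => (D i + if p < i then c else 0)⁻¹ with hup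
  set dn : ℕ → ℝ := fun i => (D i + if i ≤ p then c else 0)⁻¹ with hdn
  set T : ℕ → ℝ := fun n => (∏ i ∈ Finset.Ico 1 n, up i) * ∏ i ∈ Finset.Ico n (k + 1), dn i with hT
  set t : ℕ → ℝ := fun q => (∏ i ∈ Finset.Ico 1 (q + 1), up i) *
    ∏ i ∈ Finset.Ico q (k + 1), dn i with ht
  have hTp : T (p + 1) = ∏ i ∈ Finset.Ico 1 (k + 1), (D i)⁻¹ := by
    rw [← Finset.prod_Ico_consecutive _ (show 1 ≤ p + 1 by omega) (show p + 1 ≤ k + 1 by omega)]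
    refine congrArg₂ _ ?_ ?_ <;> refine Finset.prod_congr rfl fun i hi => ?_
    · have : ¬ p < i := by have := Finset.mem_Ico.1 hi; omega
      simp [hup, this]
    · have : ¬ i ≤ p := by have := Finset.mem_Ico.1 hi; omega
      simp [hdn, this]
  have hstep : ∀ n, 1 ≤ n → n ≤ k → t n * (c * if n ≤ p then 1 else -1) = T (n + 1) - T n := by
    intro n h1 hn
    have e1 : ∏ i ∈ Finset.Ico 1 (n + 1), up i = (∏ i ∈ Finset.Ico 1 n, up i) * up n :=
      Finset.prod_Ico_succ_top h1 _
    have e2 : ∏ i ∈ Finset.Ico n (k + 1), dn i = dn n * ∏ i ∈ Finset.Ico (n + 1) (k + 1), dn i :=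
      Finset.prod_eq_prod_Ico_succ_bot (by omega) _
    have hDn := hD n h1 hn
    have e3 : up n * dn n * (c * if n ≤ p then 1 else -1) = up n - dn n := by
      by_cases hnp : n ≤ p
      · simp only [hup, hdn, hnp, not_lt.2 hnp, if_true, if_false]
        field_simp
        ring
      · simp only [hup, hdn, hnp, not_le.1 hnp, if_true, if_false]
        field_simp
        ring
    simp only [ht, hT, e1, e2]
    linear_combination (∏ i ∈ Finset.Ico 1 n, up i) *
      (∏ i ∈ Finset.Ico (n + 1) (k + 1), dn i) * e3
  have hlow : ∀ n, n ≤ p → (∑ q ∈ Finset.range (n + 1), t q) * c = T (n + 1) := by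
    intro n
    induction n with
    | zero =>
      intro _
      have : dn 0 = c⁻¹ := by simp [hdn, h0]
      simp only [zero_add, Finset.sum_range_one, ht, hT, Finset.Ico_self, Finset.prod_empty,
        one_mul, Finset.prod_eq_prod_Ico_succ_bot (Nat.succ_pos k) dn, this]
      field_simp
    | succ n ih =>
      intro hn
      have := hstep (n + 1) (by omega) (by omega)
      rw [if_pos hn] at this
      rw [Finset.sum_range_succ, add_mul, ih (by omega)]
      linarith
  have hhigh : ∀ n, n ≤ k - p →
      (∑ q ∈ Finset.Ico (p + 1) (p + 1 + n), t q) * c = T (p + 1) - T (p + 1 + n) := by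
    intro n
    induction n with
    | zero => simp
    | succ n ih =>
      intro hn
      have := hstep (p + 1 + n) (by omega) (by omega)
      rw [if_neg (by omega)] at this
      rw [← add_assoc, Finset.sum_Ico_succ_top (by omega), add_mul, ih (by omega)]
      linarith
  have htop : t (k + 1) * c = T (k + 1) := by
    have : up (k + 1) = c⁻¹ := by simp [hup, hk, Nat.lt_succ_of_le hp]
    simp only [ht, hT, Finset.Ico_self, Finset.prod_empty, mul_one,
      Finset.prod_Ico_succ_top (Nat.succ_pos k) up, this]
    field_simp
  have h2 := hlow p le_rfl
  have h3 := hhigh (k - p) le_rfl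
  rw [show p + 1 + (k - p) = k + 1 by omega] at h3
  rw [← hTp, Finset.sum_range_succ, ← Finset.sum_range_add_sum_Ico _ (show p + 1 ≤ k + 1 by omega)]
  field_simp
  linarith

lemma sum_prod_levelSum_inv : ∀ {k : ℕ} (c : Fin k → ℝ), (∀ j, 0 < c j) →
    ∑ τ : Equiv.Perm (Fin (k + 1)), ∏ i ∈ Finset.Ico 1 (k + 1), (levelSum τ c i)⁻¹ =
      ∏ j, 2 / c j := by
  intro k
  induction k with
  | zero => intro c _; simp
  | succ k ih =>
    intro c hc
    rw [← (insertLast_bijective (k + 1)).sum_comp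
      (fun τ => ∏ i ∈ Finset.Ico 1 (k + 2), (levelSum τ c i)⁻¹), Fintype.sum_prod_type_right]
    simp only [prod_levelSum_insertLast]
    have hins : ∀ σ : Equiv.Perm (Fin (k + 1)), _ := fun σ =>
      sum_insertion_levels (D := levelSum σ fun j => c j.castSucc) (p := σ (Fin.last k))
        (hc (Fin.last k)) (Nat.le_of_lt_succ (σ (Fin.last k)).isLt) (levelSum_zero _ _)
        (levelSum_eq_zero_of_lt _ _ (Nat.lt_succ_self k))
        fun i h1 hi => levelSum_pos σ (fun j => hc j.castSucc) h1 hi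
    simp only [Finset.sum_range] at hins
    rw [Finset.sum_congr rfl fun σ _ => hins σ, ← Finset.mul_sum, ih _ fun j => hc j.castSucc,
      Fin.prod_univ_castSucc, mul_comm]

lemma F_pos {k : ℕ} (τ : Equiv.Perm (Fin (k + 1))) (i : Fin k) {l : Fin k → ℝ}
    (hl : ∀ j, 0 < l j) : 0 < F τ i l :=
  Finset.sum_pos (fun j _ => Real.sqrt_pos.2 (mul_pos two_pos (hl j))) (Eset_nonempty τ i)

lemma w_pos {k : ℕ} (τ : Equiv.Perm (Fin (k + 1))) {l : Fin k → ℝ} (hl : ∀ j, 0 < l j) :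
    0 < w τ l :=
  mul_pos (by positivity) (Finset.prod_pos fun i _ =>
    div_pos (Real.sqrt_pos.2 (mul_pos two_pos (hl i))) (F_pos τ i hl))

/-- The weights of the kernel `Q` sum to one. -/
lemma sum_w {k : ℕ} {l : Fin k → ℝ} (hl : ∀ j, 0 < l j) :
    ∑ τ : Equiv.Perm (Fin (k + 1)), w τ l = 1 := by
  have hc : ∀ j, 0 < Real.sqrt (2 * l j) := fun j => Real.sqrt_pos.2 (mul_pos two_pos (hl j))
  have hF : ∀ (τ : Equiv.Perm (Fin (k + 1))), ∏ i : Fin k, (F τ i l)⁻¹ =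
      ∏ i ∈ Finset.Ico 1 (k + 1), (levelSum τ (fun j => Real.sqrt (2 * l j)) i)⁻¹ := by
    intro τ
    rw [Finset.prod_Ico_eq_prod_range, Finset.prod_range]
    refine Finset.prod_congr rfl fun i _ => ?_
    rw [F, sum_Eset, add_comm 1]
  simp only [w, div_eq_mul_inv, Finset.prod_mul_distrib, hF]
  rw [← Finset.mul_sum, ← Finset.mul_sum, sum_prod_levelSum_inv _ hc, ← Finset.prod_mul_distrib]
  have : ∀ j, Real.sqrt (2 * l j) * (2 / Real.sqrt (2 * l j)) = 2 := fun j => by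
    have := (hc j).ne'
    field_simp
  simp only [this, Finset.prod_const, Finset.card_univ, Fintype.card_fin]
  rw [← mul_pow]
  norm_num

/-- The invariant cube `[2, 2k²]^k`. -/
def cube (k : ℕ) : Set (Fin k → ℝ) := {l | ∀ i, l i ∈ Set.Icc (2 : ℝ) (2 * (k : ℝ) ^ 2)}

/-- The action of the kernel `Q` on functions. -/
def transferOp {k : ℕ} (g : (Fin k → ℝ) → ℝ) (l : Fin k → ℝ) : ℝ :=
  ∑ τ : Equiv.Perm (Fin (k + 1)), w τ l * g fun i => F τ i l

/-- The coordinatewise logarithms of `a` and `b` differ by at most `t`. -/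
def RatioLE {k : ℕ} (t : ℝ) (a b : Fin k → ℝ) : Prop :=
  ∀ i, a i ≤ Real.exp t * b i ∧ b i ≤ Real.exp t * a i

lemma RatioLE.symm {k : ℕ} {t : ℝ} {a b : Fin k → ℝ} (h : RatioLE t a b) : RatioLE t b a :=
  fun i => (h i).symm

lemma pos_of_mem_cube {k : ℕ} {l : Fin k → ℝ} (hl : l ∈ cube k) (i : Fin k) : 0 < l i :=
  two_pos.trans_le (hl i).1

lemma cube_nonempty {k : ℕ} (hk : 1 ≤ k) : (cube k).Nonempty := by
  have : (1 : ℝ) ≤ k := by exact_mod_cast hk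
  exact ⟨fun _ => 2, fun _ => ⟨le_rfl, by nlinarith⟩⟩

lemma isCompact_cube (k : ℕ) : IsCompact (cube k) := by
  have : cube k = Set.univ.pi fun _ : Fin k => Set.Icc (2 : ℝ) (2 * (k : ℝ) ^ 2) := by
    ext l
    simp only [cube, Set.mem_ofPred_eq, Set.mem_univ_pi]
  rw [this]
  exact isCompact_univ_pi fun _ => isCompact_Icc

lemma two_le_sqrt_of_mem_cube {k : ℕ} {l : Fin k → ℝ} (hl : l ∈ cube k) (j : Fin k) :
    2 ≤ Real.sqrt (2 * l j) :=
  Real.le_sqrt_of_sq_le (by linarith [(hl j).1])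

lemma F_mem_cube {k : ℕ} (τ : Equiv.Perm (Fin (k + 1))) {l : Fin k → ℝ} (hl : l ∈ cube k) :
    (fun i => F τ i l) ∈ cube k := by
  intro i
  constructor
  · obtain ⟨j, hj⟩ := Eset_nonempty τ i
    exact (two_le_sqrt_of_mem_cube hl j).trans
      (Finset.single_le_sum (f := fun j => Real.sqrt (2 * l j)) (fun _ _ => Real.sqrt_nonneg _) hj)
  · have hle : ∀ j ∈ Eset τ i, Real.sqrt (2 * l j) ≤ 2 * k := fun j _ =>
      Real.sqrt_le_iff.2 ⟨by positivity, by nlinarith [(hl j).2]⟩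
    calc F τ i l ≤ (Eset τ i).card • (2 * (k : ℝ)) := Finset.sum_le_card_nsmul _ _ _ hle
      _ ≤ k * (2 * (k : ℝ)) := by
        rw [nsmul_eq_mul]
        gcongr
        simpa using Finset.card_le_univ (Eset τ i)
      _ = 2 * (k : ℝ) ^ 2 := by ring

lemma sqrt_le_exp_half_mul {t x y : ℝ} (h : x ≤ Real.exp t * y) :
    Real.sqrt (2 * x) ≤ Real.exp (t / 2) * Real.sqrt (2 * y) := by
  rw [Real.exp_half, ← Real.sqrt_mul (Real.exp_pos t).le]
  exact Real.sqrt_le_sqrt (by linarith)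

lemma F_le_of_ratioLE {k : ℕ} (τ : Equiv.Perm (Fin (k + 1))) {t : ℝ} {a b : Fin k → ℝ}
    (h : RatioLE t a b) (i : Fin k) : F τ i a ≤ Real.exp (t / 2) * F τ i b := by
  rw [F, F, Finset.mul_sum]
  exact Finset.sum_le_sum fun j _ => sqrt_le_exp_half_mul (h j).1

lemma RatioLE.map_F {k : ℕ} (τ : Equiv.Perm (Fin (k + 1))) {t : ℝ} {a b : Fin k → ℝ}
    (h : RatioLE t a b) : RatioLE (t / 2) (fun i => F τ i a) fun i => F τ i b :=
  fun i => ⟨F_le_of_ratioLE τ h i, F_le_of_ratioLE τ h.symm i⟩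

lemma ratioLE_of_mem_cube {k : ℕ} {a b : Fin k → ℝ} (ha : a ∈ cube k) (hb : b ∈ cube k) :
    RatioLE ((k : ℝ) ^ 2) a b := by
  have key : ∀ x ∈ Set.Icc (2 : ℝ) (2 * (k : ℝ) ^ 2), ∀ y ∈ Set.Icc (2 : ℝ) (2 * (k : ℝ) ^ 2),
      x ≤ Real.exp ((k : ℝ) ^ 2) * y := fun x hx y hy => by
    have h1 := Real.add_one_le_exp ((k : ℝ) ^ 2)
    have h2 : (k : ℝ) ^ 2 * 2 ≤ Real.exp ((k : ℝ) ^ 2) * y :=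
      mul_le_mul (by linarith) hy.1 (by norm_num) (Real.exp_pos _).le
    linarith [hx.2]
  exact fun i => ⟨key _ (ha i) _ (hb i), key _ (hb i) _ (ha i)⟩

lemma w_le_of_ratioLE {k : ℕ} (τ : Equiv.Perm (Fin (k + 1))) {t : ℝ} {a b : Fin k → ℝ}
    (ha : ∀ i, 0 < a i) (hb : ∀ i, 0 < b i) (h : RatioLE t a b) :
    w τ a ≤ Real.exp (k * t) * w τ b := by
  have hfac : ∀ i, Real.sqrt (2 * a i) / F τ i a ≤
      Real.exp t * (Real.sqrt (2 * b i) / F τ i b) := by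
    intro i
    have hFa := F_pos τ i ha
    have hFb := F_pos τ i hb
    rw [← mul_div_assoc, div_le_div_iff₀ hFa hFb]
    have h1 := sqrt_le_exp_half_mul (h i).1
    have h2 := F_le_of_ratioLE τ h.symm i
    calc Real.sqrt (2 * a i) * F τ i b
        ≤ (Real.exp (t / 2) * Real.sqrt (2 * b i)) * (Real.exp (t / 2) * F τ i a) :=
          mul_le_mul h1 h2 hFb.le (by positivity)
      _ = Real.exp t * Real.sqrt (2 * b i) * F τ i a := by
          nth_rewrite 3 [← add_halves t]
          rw [Real.exp_add]
          ring
  have hprod : ∏ i : Fin k, Real.sqrt (2 * a i) / F τ i a ≤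
      ∏ i : Fin k, Real.exp t * (Real.sqrt (2 * b i) / F τ i b) :=
    Finset.prod_le_prod (fun i _ => div_nonneg (Real.sqrt_nonneg _) (F_pos τ i ha).le)
      fun i _ => hfac i
  rw [Finset.prod_mul_distrib, Finset.prod_const, Finset.card_univ, Fintype.card_fin,
    ← Real.exp_nat_mul] at hprod
  calc w τ a ≤ (2 : ℝ)⁻¹ ^ k * (Real.exp (k * t) * ∏ i : Fin k, Real.sqrt (2 * b i) / F τ i b) :=
        mul_le_mul_of_nonneg_left hprod (by positivity)
    _ = Real.exp (k * t) * w τ b := by rw [w]; ring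

/-- A Lipschitz constant for the logarithms of the weights on the cube. -/
def weightLip (k : ℕ) : ℝ := k * Real.exp (k * (k : ℝ) ^ 2)

lemma abs_w_sub_w_le {k : ℕ} (τ : Equiv.Perm (Fin (k + 1))) {t : ℝ} (ht : 0 ≤ t)
    (htD : t ≤ (k : ℝ) ^ 2) {a b : Fin k → ℝ} (ha : ∀ i, 0 < a i) (hb : ∀ i, 0 < b i)
    (h : RatioLE t a b) : |w τ a - w τ b| ≤ weightLip k * t * (w τ a + w τ b) := by
  have hexp : Real.exp (k * t) - 1 ≤ weightLip k * t := by
    have h1 := Real.add_one_le_exp (-(k * t))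
    have h2 : Real.exp (k * t) * Real.exp (-(k * t)) = 1 := by rw [← Real.exp_add]; simp
    have h3 : Real.exp (k * t) ≤ Real.exp (k * (k : ℝ) ^ 2) := Real.exp_le_exp.2 (by gcongr)
    have h4 : (0 : ℝ) ≤ k * t := by positivity
    calc Real.exp (k * t) - 1 ≤ k * t * Real.exp (k * t) := by
          nlinarith [Real.exp_pos (k * t)]
      _ ≤ k * t * Real.exp (k * (k : ℝ) ^ 2) := mul_le_mul_of_nonneg_left h3 h4
      _ = weightLip k * t := by rw [weightLip]; ring
  have hwa := w_pos τ ha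
  have hwb := w_pos τ hb
  have h1 := w_le_of_ratioLE τ ha hb h
  have h2 := w_le_of_ratioLE τ hb ha h.symm
  have hC : 0 ≤ weightLip k * t := by rw [weightLip]; positivity
  rw [abs_le]
  constructor <;> nlinarith [mul_le_mul_of_nonneg_right hexp hwa.le,
    mul_le_mul_of_nonneg_right hexp hwb.le, mul_nonneg hC hwa.le, mul_nonneg hC hwb.le]

lemma exists_pos_le_w {k : ℕ} (hk : 1 ≤ k) (τ : Equiv.Perm (Fin (k + 1))) :
    ∃ δ : ℝ, 0 < δ ∧ δ ≤ 1 ∧ ∀ l ∈ cube k, δ ≤ w τ l := by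
  obtain ⟨b, hb⟩ := cube_nonempty hk
  have hwb := w_pos τ (pos_of_mem_cube hb)
  have hle : ∀ l ∈ cube k, Real.exp (-(k * (k : ℝ) ^ 2)) * w τ b ≤ w τ l := fun l hl => by
    have := w_le_of_ratioLE τ (pos_of_mem_cube hb) (pos_of_mem_cube hl) (ratioLE_of_mem_cube hb hl)
    rw [Real.exp_neg, inv_mul_le_iff₀ (Real.exp_pos _)]
    exact this
  refine ⟨_, by positivity, ?_, hle⟩
  refine (hle b hb).trans ?_
  rw [← sum_w (pos_of_mem_cube hb)]
  exact Finset.single_le_sum (f := fun τ => w τ b) (fun τ _ => (w_pos τ (pos_of_mem_cube hb)).le)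
    (Finset.mem_univ τ)

/-- `g` is `L`-Lipschitz on the cube in logarithmic coordinates. -/
def LogLipschitzOnCube {k : ℕ} (L : ℝ) (g : (Fin k → ℝ) → ℝ) : Prop :=
  ∀ t, 0 ≤ t → t ≤ (k : ℝ) ^ 2 → ∀ a ∈ cube k, ∀ b ∈ cube k, RatioLE t a b → |g a - g b| ≤ L * t

lemma le_transferOp {k : ℕ} {g : (Fin k → ℝ) → ℝ} {m : ℝ} (hg : ∀ l ∈ cube k, m ≤ g l)
    {l : Fin k → ℝ} (hl : l ∈ cube k) : m ≤ transferOp g l := by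
  calc m = ∑ τ, w τ l * m := by rw [← Finset.sum_mul, sum_w (pos_of_mem_cube hl), one_mul]
    _ ≤ transferOp g l := Finset.sum_le_sum fun τ _ =>
      mul_le_mul_of_nonneg_left (hg _ (F_mem_cube τ hl)) (w_pos τ (pos_of_mem_cube hl)).le

lemma transferOp_le {k : ℕ} {g : (Fin k → ℝ) → ℝ} {M : ℝ} (hg : ∀ l ∈ cube k, g l ≤ M)
    {l : Fin k → ℝ} (hl : l ∈ cube k) : transferOp g l ≤ M := by
  calc transferOp g l ≤ ∑ τ, w τ l * M := Finset.sum_le_sum fun τ _ =>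
        mul_le_mul_of_nonneg_left (hg _ (F_mem_cube τ hl)) (w_pos τ (pos_of_mem_cube hl)).le
    _ = M := by rw [← Finset.sum_mul, sum_w (pos_of_mem_cube hl), one_mul]

lemma le_transferOp_iterate {k : ℕ} {g : (Fin k → ℝ) → ℝ} {m : ℝ} (hg : ∀ l ∈ cube k, m ≤ g l)
    (n : ℕ) : ∀ l ∈ cube k, m ≤ transferOp^[n] g l := by
  induction n with
  | zero => exact hg
  | succ n ih => rw [Function.iterate_succ_apply']; exact fun l => le_transferOp ih

lemma transferOp_iterate_le {k : ℕ} {g : (Fin k → ℝ) → ℝ} {M : ℝ} (hg : ∀ l ∈ cube k, g l ≤ M)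
    (n : ℕ) : ∀ l ∈ cube k, transferOp^[n] g l ≤ M := by
  induction n with
  | zero => exact hg
  | succ n ih => rw [Function.iterate_succ_apply']; exact fun l => transferOp_le ih

lemma LogLipschitzOnCube.transferOp {k : ℕ} {L M : ℝ} {g : (Fin k → ℝ) → ℝ}
    (hL : LogLipschitzOnCube L g) (hM : ∀ l ∈ cube k, |g l| ≤ M) :
    LogLipschitzOnCube (L / 2 + 2 * weightLip k * M) (transferOp g) := by
  intro t ht htD a ha b hb hab
  have hpa := pos_of_mem_cube ha
  have hpb := pos_of_mem_cube hb
  have hterm : ∀ τ : Equiv.Perm (Fin (k + 1)),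
      |w τ a * g (fun i => F τ i a) - w τ b * g fun i => F τ i b| ≤
        w τ a * (L * (t / 2)) + weightLip k * t * (w τ a + w τ b) * M := by
    intro τ
    have h1 := hL (t / 2) (by linarith) (by linarith) _ (F_mem_cube τ ha) _ (F_mem_cube τ hb)
      (hab.map_F τ)
    have h2 := abs_w_sub_w_le τ ht htD hpa hpb hab
    have h3 := hM _ (F_mem_cube τ hb)
    calc |w τ a * g (fun i => F τ i a) - w τ b * g fun i => F τ i b|
        = |w τ a * (g (fun i => F τ i a) - g fun i => F τ i b) +
            (w τ a - w τ b) * g fun i => F τ i b| := by ring_nf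
      _ ≤ w τ a * |g (fun i => F τ i a) - g fun i => F τ i b| +
            |w τ a - w τ b| * |g fun i => F τ i b| := by
          refine (abs_add_le _ _).trans_eq ?_
          rw [abs_mul, abs_mul, abs_of_pos (w_pos τ hpa)]
      _ ≤ _ := add_le_add (mul_le_mul_of_nonneg_left h1 (w_pos τ hpa).le)
          (mul_le_mul h2 h3 (abs_nonneg _) ((abs_nonneg _).trans h2))
  calc |_root_.transferOp g a - _root_.transferOp g b|
      ≤ ∑ τ : Equiv.Perm (Fin (k + 1)),
          (w τ a * (L * (t / 2)) + weightLip k * t * (w τ a + w τ b) * M) := by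
        rw [_root_.transferOp, _root_.transferOp, ← Finset.sum_sub_distrib]
        exact (Finset.abs_sum_le_sum_abs _ _).trans (Finset.sum_le_sum fun τ _ => hterm τ)
    _ = (L / 2 + 2 * weightLip k * M) * t := by
        rw [Finset.sum_add_distrib, ← Finset.sum_mul, ← Finset.sum_mul, ← Finset.mul_sum,
          Finset.sum_add_distrib, sum_w hpa, sum_w hpb]
        ring

lemma LogLipschitzOnCube.transferOp_iterate {k : ℕ} {L M : ℝ} {g : (Fin k → ℝ) → ℝ}
    (h0 : 0 ≤ L) (hL : LogLipschitzOnCube L g) (hM : ∀ l ∈ cube k, |g l| ≤ M) (hM0 : 0 ≤ M)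
    (n : ℕ) : LogLipschitzOnCube (L + 4 * weightLip k * M) (_root_.transferOp^[n] g) := by
  have hC : 0 ≤ weightLip k * M := mul_nonneg (by rw [weightLip]; positivity) hM0
  induction n with
  | zero =>
    intro t ht htD a ha b hb hab
    refine (hL t ht htD a ha b hb hab).trans (mul_le_mul_of_nonneg_right ?_ ht)
    linarith
  | succ n ih =>
    rw [Function.iterate_succ_apply']
    have hbd : ∀ l ∈ cube k, |_root_.transferOp^[n] g l| ≤ M := fun l hl =>
      abs_le.2 ⟨le_transferOp_iterate (fun l hl => (abs_le.1 (hM l hl)).1) n l hl,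
        transferOp_iterate_le (fun l hl => (abs_le.1 (hM l hl)).2) n l hl⟩
    intro t ht htD a ha b hb hab
    refine (ih.transferOp hbd t ht htD a ha b hb hab).trans (mul_le_mul_of_nonneg_right ?_ ht)
    linarith

/-- The oscillation of `h` over the cube is at most `o`. -/
def OscLE {k : ℕ} (o : ℝ) (h : (Fin k → ℝ) → ℝ) : Prop :=
  ∀ x ∈ cube k, ∀ y ∈ cube k, h x - h y ≤ o

lemma OscLE.exists_bounds {k : ℕ} (hk : 1 ≤ k) {o : ℝ} {h : (Fin k → ℝ) → ℝ} (ho : OscLE o h) :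
    ∃ m, (∀ x ∈ cube k, m ≤ h x) ∧ ∀ x ∈ cube k, h x ≤ m + o := by
  obtain ⟨x₀, hx₀⟩ := cube_nonempty hk
  have hbdd : BddBelow (h '' cube k) := by
    refine ⟨h x₀ - o, ?_⟩
    rintro _ ⟨y, hy, rfl⟩
    linarith [ho x₀ hx₀ y hy]
  refine ⟨sInf (h '' cube k), fun x hx => csInf_le hbdd ⟨x, hx, rfl⟩, fun x hx => ?_⟩
  have : h x - o ≤ sInf (h '' cube k) := by
    refine le_csInf ⟨_, x₀, hx₀, rfl⟩ ?_
    rintro _ ⟨y, hy, rfl⟩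
    linarith [ho x hx y hy]
  linarith

lemma OscLE.transferOp_iterate {k : ℕ} (hk : 1 ≤ k) {o : ℝ} {h : (Fin k → ℝ) → ℝ}
    (ho : OscLE o h) (n : ℕ) : OscLE o (transferOp^[n] h) := by
  obtain ⟨m, h1, h2⟩ := ho.exists_bounds hk
  intro x hx y hy
  linarith [le_transferOp_iterate h1 n y hy, transferOp_iterate_le h2 n x hx]

lemma transferOp_sub_le {k : ℕ} (hk : 1 ≤ k) {o δ : ℝ} {h : (Fin k → ℝ) → ℝ} (ho : OscLE o h)
    (τ : Equiv.Perm (Fin (k + 1))) (hδ : ∀ l ∈ cube k, δ ≤ w τ l) {x y : Fin k → ℝ}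
    (hx : x ∈ cube k) (hy : y ∈ cube k) :
    transferOp h x - transferOp h y ≤
      δ * (h (fun i => F τ i x) - h fun i => F τ i y) + (1 - δ) * o := by
  obtain ⟨m, h1, h2⟩ := ho.exists_bounds hk
  have hup : w τ x * (m + o - h fun i => F τ i x) ≤ m + o - transferOp h x := by
    have := Finset.single_le_sum (f := fun σ => w σ x * (m + o - h fun i => F σ i x))
      (fun σ _ => mul_nonneg (w_pos σ (pos_of_mem_cube hx)).le
        (sub_nonneg.2 (h2 _ (F_mem_cube σ hx)))) (Finset.mem_univ τ)
    refine this.trans_eq ?_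
    simp only [mul_sub, Finset.sum_sub_distrib, ← Finset.sum_mul, sum_w (pos_of_mem_cube hx),
      one_mul, transferOp]
  have hdown : w τ y * ((h fun i => F τ i y) - m) ≤ transferOp h y - m := by
    have := Finset.single_le_sum (f := fun σ => w σ y * ((h fun i => F σ i y) - m))
      (fun σ _ => mul_nonneg (w_pos σ (pos_of_mem_cube hy)).le
        (sub_nonneg.2 (h1 _ (F_mem_cube σ hy)))) (Finset.mem_univ τ)
    refine this.trans_eq ?_
    simp only [mul_sub, Finset.sum_sub_distrib, ← Finset.sum_mul, sum_w (pos_of_mem_cube hy),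
      one_mul, transferOp]
  have h3 := mul_le_mul_of_nonneg_right (hδ x hx) (sub_nonneg.2 (h2 _ (F_mem_cube τ hx)))
  have h4 := mul_le_mul_of_nonneg_right (hδ y hy) (sub_nonneg.2 (h1 _ (F_mem_cube τ hy)))
  linarith

lemma transferOp_iterate_sub_le {k : ℕ} (hk : 1 ≤ k) {o δ K : ℝ} {h : (Fin k → ℝ) → ℝ}
    (ho : OscLE o h) (hK : LogLipschitzOnCube K h) (τ : Equiv.Perm (Fin (k + 1))) (h0 : 0 ≤ δ)
    (hδ : ∀ l ∈ cube k, δ ≤ w τ l) (n : ℕ) {t : ℝ} (ht : 0 ≤ t) (htD : t ≤ (k : ℝ) ^ 2)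
    {x y : Fin k → ℝ} (hx : x ∈ cube k) (hy : y ∈ cube k) (hxy : RatioLE t x y) :
    transferOp^[n] h x - transferOp^[n] h y ≤ δ ^ n * (K * (t / 2 ^ n)) + (1 - δ ^ n) * o := by
  induction n generalizing t x y with
  | zero =>
    simpa using (abs_le.1 (hK t ht htD x hx y hy hxy)).2
  | succ n ih =>
    rw [Function.iterate_succ_apply']
    have h1 := transferOp_sub_le hk (ho.transferOp_iterate hk n) τ hδ hx hy
    have h2 := ih (by linarith) (by linarith) (F_mem_cube τ hx) (F_mem_cube τ hy) (hxy.map_F τ)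
    calc _ ≤ _ := h1
      _ ≤ δ * (δ ^ n * (K * (t / 2 / 2 ^ n)) + (1 - δ ^ n) * o) + (1 - δ) * o := by gcongr
      _ = _ := by
        rw [div_div, ← pow_succ']
        ring

lemma exists_oscLE_transferOp_iterate {k : ℕ} (hk : 1 ≤ k) {L M : ℝ} {g : (Fin k → ℝ) → ℝ}
    (h0 : 0 ≤ L) (hL : LogLipschitzOnCube L g) (hM : ∀ l ∈ cube k, |g l| ≤ M) {ε : ℝ}
    (hε : 0 < ε) : ∃ N, OscLE ε (transferOp^[N] g) := by
  have hM0 : 0 ≤ M := by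
    obtain ⟨x, hx⟩ := cube_nonempty hk
    exact (abs_nonneg _).trans (hM x hx)
  obtain ⟨δ, hδ0, hδ1, hδ⟩ := exists_pos_le_w hk 1
  set K := L + 4 * weightLip k * M
  have hK := hL.transferOp_iterate h0 hM hM0
  obtain ⟨m, hm⟩ : ∃ m : ℕ, K * ((k : ℝ) ^ 2 / 2 ^ m) ≤ ε / 2 := by
    have h1 : Filter.Tendsto (fun m : ℕ => K * (k : ℝ) ^ 2 * (1 / 2 : ℝ) ^ m) Filter.atTop
        (nhds (K * (k : ℝ) ^ 2 * 0)) :=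
      (tendsto_pow_atTop_nhds_zero_of_lt_one (by norm_num) (by norm_num)).const_mul _
    rw [mul_zero] at h1
    obtain ⟨m, hm⟩ := (h1.eventually_le_const (half_pos hε)).exists
    refine ⟨m, le_of_eq_of_le ?_ hm⟩
    rw [one_div, inv_pow]
    ring
  have hround : ∀ j : ℕ, OscLE (ε / 2 + (1 - δ ^ m) ^ j * (2 * M)) (transferOp^[m * j] g) := by
    intro j
    induction j with
    | zero =>
      intro x hx y hy
      have h1 := abs_le.1 (hM x hx)
      have h2 := abs_le.1 (hM y hy)
      simp only [mul_zero, Function.iterate_zero, id_eq, pow_zero, one_mul]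
      linarith [h1.2, h2.1]
    | succ j ih =>
      intro x hx y hy
      rw [mul_add, mul_one, add_comm, Function.iterate_add_apply]
      have := transferOp_iterate_sub_le hk ih (hK (m * j)) 1 hδ0.le hδ m (sq_nonneg (k : ℝ))
        le_rfl hx hy (ratioLE_of_mem_cube hx hy)
      refine this.trans ?_
      have h2 := mul_le_mul_of_nonneg_left hm (pow_nonneg hδ0.le m)
      calc _ ≤ δ ^ m * (ε / 2) + (1 - δ ^ m) * (ε / 2 + (1 - δ ^ m) ^ j * (2 * M)) := by gcongr
        _ = _ := by ring
  have hδm0 : 0 < δ ^ m := pow_pos hδ0 m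
  have hδm1 : δ ^ m ≤ 1 := pow_le_one₀ hδ0.le hδ1
  have h1 : Filter.Tendsto (fun j : ℕ => (1 - δ ^ m) ^ j * (2 * M)) Filter.atTop
      (nhds (0 * (2 * M))) :=
    (tendsto_pow_atTop_nhds_zero_of_lt_one (by linarith) (by linarith)).mul_const _
  rw [zero_mul] at h1
  obtain ⟨j, hj⟩ := (h1.eventually_le_const (half_pos hε)).exists
  exact ⟨m * j, fun x hx y hy => (hround j x hx y hy).trans (by linarith)⟩

lemma logLipschitzOnCube_of_lipschitzWith {k : ℕ} {C : NNReal} {f : (Fin k → ℝ) → ℝ}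
    (hf : LipschitzWith C f) :
    LogLipschitzOnCube (C * (Real.exp ((k : ℝ) ^ 2) * (2 * (k : ℝ) ^ 2))) f := by
  intro t ht htD a ha b hb hab
  have hexp : Real.exp t - 1 ≤ t * Real.exp ((k : ℝ) ^ 2) := by
    have h1 := Real.add_one_le_exp (-t)
    have h2 : Real.exp t * Real.exp (-t) = 1 := by rw [← Real.exp_add]; simp
    have h3 : Real.exp t ≤ Real.exp ((k : ℝ) ^ 2) := Real.exp_le_exp.2 htD
    nlinarith [Real.exp_pos t, mul_le_mul_of_nonneg_left h3 ht]
  have key : ∀ x ∈ Set.Icc (2 : ℝ) (2 * (k : ℝ) ^ 2), ∀ y, y ≤ Real.exp t * x →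
      y - x ≤ Real.exp ((k : ℝ) ^ 2) * (2 * (k : ℝ) ^ 2) * t := by
    intro x hx y hy
    have hx0 : 0 ≤ x := by linarith [hx.1]
    calc y - x ≤ (Real.exp t - 1) * x := by linarith
      _ ≤ (t * Real.exp ((k : ℝ) ^ 2)) * (2 * (k : ℝ) ^ 2) :=
        mul_le_mul hexp hx.2 hx0 (by positivity)
      _ = _ := by ring
  have hd : dist a b ≤ Real.exp ((k : ℝ) ^ 2) * (2 * (k : ℝ) ^ 2) * t := by
    refine (dist_pi_le_iff (by positivity)).2 fun i => ?_
    rw [Real.dist_eq, abs_le]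
    constructor
    · linarith [key _ (ha i) _ (hab i).2]
    · exact key _ (hb i) _ (hab i).1
  calc |f a - f b| ≤ C * dist a b := by rw [← Real.dist_eq]; exact hf.dist_le_mul a b
    _ ≤ C * (Real.exp ((k : ℝ) ^ 2) * (2 * (k : ℝ) ^ 2) * t) := by gcongr
    _ = _ := by ring

lemma exists_uniform_limit_transferOp {k : ℕ} (hk : 1 ≤ k) {L M : ℝ} {g : (Fin k → ℝ) → ℝ}
    (h0 : 0 ≤ L) (hL : LogLipschitzOnCube L g) (hM : ∀ l ∈ cube k, |g l| ≤ M) :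
    ∃ c : ℝ, ∀ ε > 0, ∃ N, ∀ n ≥ N, ∀ x ∈ cube k, |transferOp^[n] g x - c| ≤ ε := by
  obtain ⟨x₀, hx₀⟩ := cube_nonempty hk
  have hband : ∀ ε > 0, ∃ N, ∃ m, ∀ n ≥ N, ∀ x ∈ cube k,
      m ≤ transferOp^[n] g x ∧ transferOp^[n] g x ≤ m + ε := by
    intro ε hε
    obtain ⟨N, hN⟩ := exists_oscLE_transferOp_iterate hk h0 hL hM hε
    obtain ⟨m, h1, h2⟩ := hN.exists_bounds hk
    refine ⟨N, m, fun n hn x hx => ?_⟩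
    obtain ⟨j, rfl⟩ := Nat.exists_eq_add_of_le' hn
    rw [Function.iterate_add_apply]
    exact ⟨le_transferOp_iterate h1 j x hx, transferOp_iterate_le h2 j x hx⟩
  have hcauchy : CauchySeq fun n => transferOp^[n] g x₀ := by
    refine Metric.cauchySeq_iff'.2 fun ε hε => ?_
    obtain ⟨N, m, h⟩ := hband (ε / 2) (half_pos hε)
    refine ⟨N, fun n hn => ?_⟩
    have h1 := h n hn x₀ hx₀
    have h2 := h N le_rfl x₀ hx₀
    rw [Real.dist_eq, abs_lt]
    constructor <;> linarith [h1.1, h1.2, h2.1, h2.2]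
  obtain ⟨c, hc⟩ := cauchySeq_tendsto_of_complete hcauchy
  refine ⟨c, fun ε hε => ?_⟩
  obtain ⟨N, m, h⟩ := hband ε hε
  have hc1 : m ≤ c := ge_of_tendsto hc
    (Filter.eventually_atTop.2 ⟨N, fun n hn => (h n hn x₀ hx₀).1⟩)
  have hc2 : c ≤ m + ε := le_of_tendsto hc
    (Filter.eventually_atTop.2 ⟨N, fun n hn => (h n hn x₀ hx₀).2⟩)
  refine ⟨N, fun n hn x hx => abs_le.2 ?_⟩
  have := h n hn x hx
  constructor <;> linarith [this.1, this.2]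

@[fun_prop]
lemma measurable_F {k : ℕ} (τ : Equiv.Perm (Fin (k + 1))) (i : Fin k) : Measurable (F τ i) := by
  unfold F
  fun_prop

@[fun_prop]
lemma measurable_w {k : ℕ} (τ : Equiv.Perm (Fin (k + 1))) : Measurable (w τ) := by
  unfold w
  fun_prop

lemma measurable_transferOp {k : ℕ} {g : (Fin k → ℝ) → ℝ} (hg : Measurable g) :
    Measurable (transferOp g) := by
  unfold transferOp
  fun_prop

lemma measurable_transferOp_iterate {k : ℕ} {g : (Fin k → ℝ) → ℝ} (hg : Measurable g) (n : ℕ) :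
    Measurable (transferOp^[n] g) := by
  induction n with
  | zero => exact hg
  | succ n ih => rw [Function.iterate_succ_apply']; exact measurable_transferOp ih

lemma measurable_Qker {k : ℕ} : Measurable (Qker (k := k)) := by
  refine Measure.measurable_of_measurable_coe _ fun s hs => ?_
  simp only [Qker, Measure.coe_finsetSum, Finset.sum_apply, Measure.smul_apply,
    Measure.dirac_apply' _ hs, smul_eq_mul]
  refine Finset.measurable_sum _ fun τ _ => Measurable.mul (by fun_prop) ?_
  exact (measurable_const.indicator hs).comp (measurable_pi_lambda _ fun i => measurable_F τ i)

/-- `Qker` bundled as a kernel. -/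
def QKernel (k : ℕ) : Kernel (Fin k → ℝ) (Fin k → ℝ) := ⟨Qker, measurable_Qker⟩

lemma isProbabilityMeasure_Qker {k : ℕ} {l : Fin k → ℝ} (hl : ∀ i, 0 < l i) :
    IsProbabilityMeasure (Qker l) := by
  constructor
  simp only [Qker, Measure.coe_finsetSum, Finset.sum_apply, Measure.smul_apply,
    measure_univ, smul_eq_mul, mul_one]
  rw [← ENNReal.ofReal_sum_of_nonneg fun τ _ => (w_pos τ hl).le, sum_w hl, ENNReal.ofReal_one]

lemma Qker_compl_cube {k : ℕ} {l : Fin k → ℝ} (hl : l ∈ cube k) : Qker l (cube k)ᶜ = 0 := by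
  simp only [Qker, Measure.coe_finsetSum, Finset.sum_apply, Measure.smul_apply,
    Measure.dirac_apply' _ (isCompact_cube k).measurableSet.compl, smul_eq_mul]
  refine Finset.sum_eq_zero fun τ _ => ?_
  rw [Set.indicator_of_notMem (Set.notMem_compl_iff.2 (F_mem_cube τ hl)), mul_zero]

lemma integral_Qker {k : ℕ} (g : (Fin k → ℝ) → ℝ) {l : Fin k → ℝ} (hl : ∀ i, 0 < l i) :
    ∫ x, g x ∂Qker l = transferOp g l := by
  rw [Qker, integral_finsetSum_measure fun τ _ =>
    (integrable_dirac (by simp)).smul_measure ENNReal.ofReal_ne_top]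
  refine Finset.sum_congr rfl fun τ _ => ?_
  rw [integral_smul_measure, integral_dirac, ENNReal.toReal_ofReal (w_pos τ hl).le, smul_eq_mul]

lemma bind_Qker_compl_cube {k : ℕ} {ν : Measure (Fin k → ℝ)} (hν : ν (cube k)ᶜ = 0) :
    ν.bind Qker (cube k)ᶜ = 0 := by
  rw [Measure.bind_apply (isCompact_cube k).measurableSet.compl measurable_Qker.aemeasurable]
  refine (lintegral_eq_zero_iff ((Measure.measurable_coe
    (isCompact_cube k).measurableSet.compl).comp measurable_Qker)).2 ?_
  filter_upwards [mem_ae_iff.2 hν] with l hl using Qker_compl_cube hl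

lemma isProbabilityMeasure_bind_Qker {k : ℕ} {ν : Measure (Fin k → ℝ)} [IsProbabilityMeasure ν]
    (hν : ν (cube k)ᶜ = 0) : IsProbabilityMeasure (ν.bind Qker) := by
  constructor
  rw [Measure.bind_apply MeasurableSet.univ measurable_Qker.aemeasurable]
  have : ∀ᵐ l ∂ν, Qker l Set.univ = 1 := by
    filter_upwards [mem_ae_iff.2 hν] with l hl
    exact (isProbabilityMeasure_Qker (pos_of_mem_cube hl)).measure_univ
  rw [lintegral_congr_ae this]
  simp

lemma integrable_of_bounded_on_cube {k : ℕ} {ν : Measure (Fin k → ℝ)} [IsFiniteMeasure ν]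
    (hν : ν (cube k)ᶜ = 0) {g : (Fin k → ℝ) → ℝ} (hg : Measurable g) {M : ℝ}
    (hM : ∀ l ∈ cube k, |g l| ≤ M) : Integrable g ν := by
  refine Integrable.of_bound hg.aestronglyMeasurable M ?_
  filter_upwards [mem_ae_iff.2 hν] with l hl using hM l hl

lemma integral_bind_Qker {k : ℕ} {ν : Measure (Fin k → ℝ)} [IsProbabilityMeasure ν]
    (hν : ν (cube k)ᶜ = 0) {g : (Fin k → ℝ) → ℝ} (hg : Measurable g) {M : ℝ}
    (hM : ∀ l ∈ cube k, |g l| ≤ M) :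
    ∫ x, g x ∂(ν.bind Qker) = ∫ x, transferOp g x ∂ν := by
  have := isProbabilityMeasure_bind_Qker hν
  have hint := integrable_of_bounded_on_cube (bind_Qker_compl_cube hν) hg hM
  have hcomp := Kernel.integral_comp (κ := Kernel.const Unit ν) (η := QKernel k) (a := ()) (f := g)
  simp only [Kernel.comp_apply, Kernel.const_apply] at hcomp
  refine (hcomp hint).trans (integral_congr_ae ?_)
  filter_upwards [mem_ae_iff.2 hν] with l hl using integral_Qker g (pos_of_mem_cube hl)

lemma abs_transferOp_le {k : ℕ} {g : (Fin k → ℝ) → ℝ} {M : ℝ} (hM : ∀ l ∈ cube k, |g l| ≤ M) :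
    ∀ l ∈ cube k, |transferOp g l| ≤ M := fun _ hl =>
  abs_le.2 ⟨le_transferOp (fun l hl => (abs_le.1 (hM l hl)).1) hl,
    transferOp_le (fun l hl => (abs_le.1 (hM l hl)).2) hl⟩

lemma bind_Qker_iterate {k : ℕ} {ν : Measure (Fin k → ℝ)} [IsProbabilityMeasure ν]
    (hν : ν (cube k)ᶜ = 0) (n : ℕ) :
    IsProbabilityMeasure ((fun μ : Measure (Fin k → ℝ) => μ.bind Qker)^[n] ν) ∧
      (fun μ : Measure (Fin k → ℝ) => μ.bind Qker)^[n] ν (cube k)ᶜ = 0 := by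
  induction n with
  | zero => exact ⟨‹_›, hν⟩
  | succ n ih =>
    rw [Function.iterate_succ_apply']
    have := ih.1
    exact ⟨isProbabilityMeasure_bind_Qker ih.2, bind_Qker_compl_cube ih.2⟩

lemma integral_bind_Qker_iterate {k : ℕ} {ν : Measure (Fin k → ℝ)} [IsProbabilityMeasure ν]
    (hν : ν (cube k)ᶜ = 0) {g : (Fin k → ℝ) → ℝ} (hg : Measurable g) {M : ℝ}
    (hM : ∀ l ∈ cube k, |g l| ≤ M) (n : ℕ) :
    ∫ x, g x ∂((fun μ : Measure (Fin k → ℝ) => μ.bind Qker)^[n] ν) =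
      ∫ x, transferOp^[n] g x ∂ν := by
  induction n generalizing g with
  | zero => rfl
  | succ n ih =>
    obtain ⟨_, hn⟩ := bind_Qker_iterate hν n
    rw [Function.iterate_succ_apply', Function.iterate_succ_apply, integral_bind_Qker hn hg hM,
      ih (measurable_transferOp hg) (abs_transferOp_le hM)]

/-- The integrals of a Lipschitz function under the laws of the chain converge, to a limit
which does not depend on the initial law. -/
lemma exists_tendsto_integral {k : ℕ} (hk : 1 ≤ k) {L M : ℝ} {g : (Fin k → ℝ) → ℝ}
    (h0 : 0 ≤ L) (hL : LogLipschitzOnCube L g) (hg : Measurable g)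
    (hM : ∀ l ∈ cube k, |g l| ≤ M) :
    ∃ c : ℝ, ∀ ν : Measure (Fin k → ℝ), IsProbabilityMeasure ν → ν (cube k)ᶜ = 0 →
      Filter.Tendsto
        (fun n => ∫ x, g x ∂((fun μ : Measure (Fin k → ℝ) => μ.bind Qker)^[n] ν))
        Filter.atTop (nhds c) := by
  obtain ⟨c, hc⟩ := exists_uniform_limit_transferOp hk h0 hL hM
  refine ⟨c, fun ν _ hν => Metric.tendsto_atTop.2 fun ε hε => ?_⟩
  obtain ⟨N, hN⟩ := hc (ε / 2) (half_pos hε)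
  refine ⟨N, fun n hn => ?_⟩
  have hbd : ∀ l ∈ cube k, |transferOp^[n] g l| ≤ M := fun l hl =>
    abs_le.2 ⟨le_transferOp_iterate (fun l hl => (abs_le.1 (hM l hl)).1) n l hl,
      transferOp_iterate_le (fun l hl => (abs_le.1 (hM l hl)).2) n l hl⟩
  have hint := integrable_of_bounded_on_cube hν (measurable_transferOp_iterate hg n) hbd
  have hle : ‖∫ x, (transferOp^[n] g x - c) ∂ν‖ ≤ ε / 2 * ν.real Set.univ := by
    refine norm_integral_le_of_norm_le_const ?_
    filter_upwards [mem_ae_iff.2 hν] with x hx using hN n hn x hx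
  rw [integral_sub hint (integrable_const c)] at hle
  simp only [integral_const, probReal_univ, one_smul, mul_one] at hle
  rw [integral_bind_Qker_iterate hν hg hM, dist_eq_norm]
  linarith

lemma exists_tendsto_integral_of_lipschitzWith {k : ℕ} (hk : 1 ≤ k) {C : NNReal} {M : ℝ}
    {f : (Fin k → ℝ) → ℝ} (hf : LipschitzWith C f) (hM : ∀ x y, dist (f x) (f y) ≤ M) :
    ∃ c : ℝ, ∀ ν : Measure (Fin k → ℝ), IsProbabilityMeasure ν → ν (cube k)ᶜ = 0 →
      Filter.Tendsto
        (fun n => ∫ x, f x ∂((fun μ : Measure (Fin k → ℝ) => μ.bind Qker)^[n] ν))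
        Filter.atTop (nhds c) := by
  refine exists_tendsto_integral hk (M := M + |f 0|) (by positivity)
    (logLipschitzOnCube_of_lipschitzWith hf) hf.continuous.measurable fun l _ => ?_
  have h1 := hM l 0
  rw [Real.dist_eq] at h1
  linarith [abs_sub_abs_le_abs_sub (f l) (f 0)]

/-- A probability measure on the cube attracting, along Lipschitz functions, all the laws of the
chain. -/
lemma exists_limit_measure {k : ℕ} (hk : 1 ≤ k) :
    ∃ μ : Measure (Fin k → ℝ), IsProbabilityMeasure μ ∧ μ (cube k)ᶜ = 0 ∧
      ∀ f : (Fin k → ℝ) → ℝ, (∃ M, ∀ x y, dist (f x) (f y) ≤ M) → (∃ C, LipschitzWith C f) →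
        ∀ ν : Measure (Fin k → ℝ), IsProbabilityMeasure ν → ν (cube k)ᶜ = 0 →
          Filter.Tendsto
            (fun n => ∫ x, f x ∂((fun μ : Measure (Fin k → ℝ) => μ.bind Qker)^[n] ν))
            Filter.atTop (nhds (∫ x, f x ∂μ)) := by
  obtain ⟨x₀, hx₀⟩ := cube_nonempty hk
  have hδ : Measure.dirac x₀ (cube k)ᶜ = 0 := by
    rw [Measure.dirac_apply' _ (isCompact_cube k).measurableSet.compl,
      Set.indicator_of_notMem (Set.notMem_compl_iff.2 hx₀)]
  have hprob := fun n => (bind_Qker_iterate hδ n).1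
  let ρ : ℕ → FiniteMeasure (Fin k → ℝ) := fun n =>
    ⟨(fun μ : Measure (Fin k → ℝ) => μ.bind Qker)^[n] (Measure.dirac x₀), inferInstance⟩
  have hmem : ∀ n, ρ n ∈ {μ : FiniteMeasure (Fin k → ℝ) | μ.mass ≤ 1 ∧ μ (cube k)ᶜ = 0} := by
    intro n
    constructor
    · rw [← ENNReal.coe_le_coe, FiniteMeasure.ennreal_mass]
      exact (hprob n).measure_univ.le
    · rw [FiniteMeasure.null_iff_toMeasure_null]
      exact (bind_Qker_iterate hδ n).2
  obtain ⟨μ, hμ, hlim⟩ := (isCompact_setOfPred_finiteMeasure_le_of_isCompact 1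
    (isCompact_cube k)).ultrafilter_le_nhds' ((Filter.hyperfilter ℕ).map ρ)
    (Filter.mem_map.2 (Filter.univ_mem' hmem))
  have hlim' : Filter.Tendsto ρ (Filter.hyperfilter ℕ) (nhds μ) := hlim
  rw [FiniteMeasure.tendsto_iff_forall_integral_tendsto] at hlim'
  have hone : (μ : Measure (Fin k → ℝ)).real Set.univ = 1 := by
    have h1 := hlim' (BoundedContinuousFunction.const _ 1)
    have h2 : ∀ n, (ρ n : Measure (Fin k → ℝ)).real Set.univ = 1 := fun n => by
      have := hprob n
      exact probReal_univ (μ := (fun μ : Measure (Fin k → ℝ) => μ.bind Qker)^[n]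
        (Measure.dirac x₀))
    simp only [BoundedContinuousFunction.const_apply, integral_const, h2, smul_eq_mul,
      mul_one] at h1
    exact tendsto_nhds_unique h1 tendsto_const_nhds
  refine ⟨μ, ⟨?_⟩, (FiniteMeasure.null_iff_toMeasure_null _ _).1 hμ.2, ?_⟩
  · rw [← ENNReal.toReal_eq_one_iff]
    exact hone
  · rintro f ⟨M, hM⟩ ⟨C, hf⟩ ν hν hνS
    obtain ⟨c, hc⟩ := exists_tendsto_integral_of_lipschitzWith hk hf hM
    have h1 := hlim' ⟨⟨f, hf.continuous⟩, M, hM⟩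
    have h2 := (hc _ inferInstance hδ).mono_left Nat.hyperfilter_le_atTop
    have h3 : ∫ x, f x ∂(μ : Measure (Fin k → ℝ)) = c := tendsto_nhds_unique h1 h2
    rw [h3]
    exact hc ν hν hνS

/-- the kernel `Q` is ergodic on `[2, 2k²]^k`: there is a probability
measure `ν_k` on `(0,∞)^k` such that, for every starting probability measure `ν⁰`
supported in the cube, the laws `ν⁰Qⁿ` converge weakly to `ν_k`. -/
theorem stmt9 {k : ℕ} (hk : 1 ≤ k) :
    ∃ νk : Measure (Fin k → ℝ), IsProbabilityMeasure νk ∧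
      νk {l : Fin k → ℝ | ∀ i, 0 < l i} = 1 ∧
      ∀ ν0 : Measure (Fin k → ℝ), IsProbabilityMeasure ν0 →
        ν0 {l : Fin k → ℝ | ∀ i, l i ∈ Set.Icc (2 : ℝ) (2 * (k : ℝ) ^ 2)} = 1 →
        ∀ f : BoundedContinuousFunction (Fin k → ℝ) ℝ,
          Filter.Tendsto
            (fun n => ∫ x, f x ∂((fun μ : Measure (Fin k → ℝ) => μ.bind Qker)^[n] ν0))
            Filter.atTop (nhds (∫ x, f x ∂νk)) := by
  obtain ⟨μ, hμ, hμS, hlim⟩ := exists_limit_measure hk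
  refine ⟨μ, hμ, (prob_compl_eq_zero_iff ?_).1 (measure_mono_null ?_ hμS), ?_⟩
  · simp only [Set.ofPred_forall]
    exact MeasurableSet.iInter fun i => measurableSet_lt measurable_const (measurable_pi_apply i)
  · exact Set.compl_subset_compl.2 fun l hl => pos_of_mem_cube hl
  · intro ν0 hν0 hcube f
    have hS : ν0 (cube k)ᶜ = 0 := (prob_compl_eq_zero_iff (isCompact_cube k).measurableSet).2 hcube
    let P : ℕ → ProbabilityMeasure (Fin k → ℝ) := fun n => ⟨_, (bind_Qker_iterate hS n).1⟩
    have hP : Filter.Tendsto P Filter.atTop (nhds ⟨μ, hμ⟩) :=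
      tendsto_iff_forall_lipschitz_integral_tendsto.2 fun g hg hgL => hlim g hg hgL ν0 hν0 hS
    exact ProbabilityMeasure.tendsto_iff_forall_integral_tendsto.1 hP f
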